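/- Let n be a positive natural number and let ℓ∞_n denote ℝⁿ with the cone of entrywise nonnegative vectors and order unit (1, …, 1). Then for every real AOU space W, every element of the injective cone (ℓ∞_n ⊗_ε W)⁺ can be written as a finite sum Σᵢ vᵢ ⊗ wᵢ with vᵢ entrywise nonnegative and wᵢ ∈ W⁺; consequently (ℓ∞_n ⊗_ε W)⁺ = (ℓ∞_n ⊗_π W)⁺, i.e. ℓ∞_n is a nuclear real AOU space. -/

import Mathlib

open TensorProduct

/-- A real AOU space structure on a real vector space `V`: a proper cone together with
an Archimedean order unit. -/
structure AOU (V : Type*) [AddCommGroup V] [Module ℝ V] where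
  pos : Set V
  unit : V
  zero_mem : (0 : V) ∈ pos
  add_mem : ∀ ⦃x y : V⦄, x ∈ pos → y ∈ pos → x + y ∈ pos
  smul_mem : ∀ ⦃r : ℝ⦄, 0 ≤ r → ∀ ⦃x : V⦄, x ∈ pos → r • x ∈ pos
  proper : ∀ x : V, x ∈ pos → -x ∈ pos → x = 0
  exists_orderUnit : ∀ v : V, ∃ r : ℝ, 0 < r ∧ r • unit - v ∈ pos
  arch : ∀ v : V, (∀ ε : ℝ, 0 < ε → ε • unit + v ∈ pos) → v ∈ pos

variable {V W : Type*} [AddCommGroup V] [Module ℝ V] [AddCommGroup W] [Module ℝ W]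

/-- A state on a real AOU space: a unital positive linear functional. -/
def IsState (A : AOU V) (f : V →ₗ[ℝ] ℝ) : Prop :=
  f A.unit = 1 ∧ ∀ v ∈ A.pos, 0 ≤ f v

/-- The tensor product functional `f ⊗ g` on `V ⊗ W`, with `(f ⊗ g)(v ⊗ w) = f v * g w`. -/
noncomputable def tensFun (f : V →ₗ[ℝ] ℝ) (g : W →ₗ[ℝ] ℝ) :
    TensorProduct ℝ V W →ₗ[ℝ] ℝ :=
  TensorProduct.lift (f.smulRight g)

/-- The injective cone `(V ⊗_ε W)⁺`. -/
def injCone (A : AOU V) (B : AOU W) : Set (TensorProduct ℝ V W) :=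
  {z | ∀ (f : V →ₗ[ℝ] ℝ) (g : W →ₗ[ℝ] ℝ), IsState A f → IsState B g → 0 ≤ tensFun f g z}

/-- The set `V⁺ ⊗ W⁺` of finite sums of elementary tensors of positive elements. -/
def simpleCone (A : AOU V) (B : AOU W) : Set (TensorProduct ℝ V W) :=
  {z | ∃ (n : ℕ) (v : Fin n → V) (w : Fin n → W),
    (∀ i, v i ∈ A.pos) ∧ (∀ i, w i ∈ B.pos) ∧ z = ∑ i, v i ⊗ₜ[ℝ] w i}

/-- The projective cone `(V ⊗_π W)⁺`. -/
def projCone (A : AOU V) (B : AOU W) : Set (TensorProduct ℝ V W) :=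
  {z | ∀ ε : ℝ, 0 < ε → z + ε • (A.unit ⊗ₜ[ℝ] B.unit) ∈ simpleCone A B}

/-- The order norm determined by a cone `pos` and order unit `e`. -/
noncomputable def gNorm {X : Type*} [AddCommGroup X] [Module ℝ X]
    (pos : Set X) (e : X) (x : X) : ℝ :=
  sInf {r : ℝ | 0 < r ∧ r • e - x ∈ pos ∧ r • e + x ∈ pos}

/-- `ℓ∞_n`: `ℝⁿ` with the entrywise nonnegative cone and order unit `(1, …, 1)`. -/
def ellInf (n : ℕ) : AOU (Fin n → ℝ) where
  pos := {v | ∀ i, 0 ≤ v i}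
  unit := fun _ => 1
  zero_mem := fun _ => le_refl 0
  add_mem := fun x y hx hy i => add_nonneg (hx i) (hy i)
  smul_mem := fun r hr x hx i => by simpa using mul_nonneg hr (hx i)
  proper := fun x hx hnx => funext fun i =>
    le_antisymm (by simpa using hnx i) (hx i)
  exists_orderUnit := fun v =>
    ⟨1 + ∑ i, |v i|, by positivity, fun i => by
      have h1 : v i ≤ |v i| := le_abs_self _
      have h2 : |v i| ≤ ∑ j, |v j| :=
        Finset.single_le_sum (fun j _ => abs_nonneg (v j)) (Finset.mem_univ i)
      simp only [Pi.sub_apply, Pi.smul_apply, smul_eq_mul, mul_one]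
      linarith⟩
  arch := fun v h i => by
    by_contra hneg
    push_neg at hneg
    have h2 := h (-(v i) / 2) (by linarith) i
    simp only [Pi.add_apply, Pi.smul_apply, smul_eq_mul, mul_one] at h2
    linarith

theorem AOU.unit_mem (B : AOU W) : B.unit ∈ B.pos := by
  obtain ⟨r, hr, h⟩ := B.exists_orderUnit 0
  have h1 := B.smul_mem (inv_nonneg.mpr hr.le) h
  rwa [sub_zero, inv_smul_smul₀ hr.ne'] at h1

theorem AOU.mem_of_unit_eq_zero (B : AOU W) (h : B.unit = 0) (w : W) : w ∈ B.pos := by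
  obtain ⟨r, -, hr⟩ := B.exists_orderUnit (-w)
  simpa [h] using hr

/-- The convex cone generated by the positive cone of an AOU space and a vector `-u`. -/
def AOU.coneSub (B : AOU W) (u : W) : PointedCone ℝ W where
  carrier := {x | ∃ c : ℝ, 0 ≤ c ∧ x + c • u ∈ B.pos}
  zero_mem' := ⟨0, le_rfl, by simpa using B.zero_mem⟩
  smul_mem' := by
    rintro ⟨r, hr⟩ x ⟨c, hc, hx⟩
    refine ⟨r * c, mul_nonneg hr hc, ?_⟩
    have h := B.smul_mem hr hx
    rwa [smul_add, ← mul_smul] at h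
  add_mem' := by
    rintro x y ⟨c, hc, hx⟩ ⟨d, hd, hy⟩
    refine ⟨c + d, add_nonneg hc hd, ?_⟩
    have h := B.add_mem hx hy
    rwa [add_add_add_comm, ← add_smul] at h

/-- A vector outside the positive cone has a state which is nonpositive on it. -/
theorem AOU.exists_isState_nonpos (B : AOU W) {u : W} (hu : u ∉ B.pos) :
    ∃ g : W →ₗ[ℝ] ℝ, IsState B g ∧ g u ≤ 0 := by
  have he : B.unit ≠ 0 := fun h => hu (B.mem_of_unit_eq_zero h u)
  obtain ⟨g, hg, hpos⟩ := riesz_extension (B.coneSub u)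
    (LinearPMap.mkSpanSingleton B.unit (1 : ℝ) he) (by
      rintro ⟨x, hx⟩ ⟨c, hc, hxc⟩
      obtain ⟨t, rfl⟩ := Submodule.mem_span_singleton.mp hx
      refine le_of_le_of_eq ?_ (LinearPMap.mkSpanSingleton'_apply B.unit (1 : ℝ) _ t hx).symm
      rw [RingHom.id_apply, smul_eq_mul, mul_one]
      by_contra! ht
      have hcu : c • u ∈ B.pos := by
        have h := B.add_mem hxc (B.smul_mem (neg_nonneg.mpr ht.le) B.unit_mem)
        convert h using 1
        module
      rcases hc.eq_or_lt with rfl | hc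
      · have h0 : t • B.unit = 0 := B.proper _ (by simpa using hxc) (by
          simpa using B.smul_mem (neg_nonneg.mpr ht.le) B.unit_mem)
        exact (smul_ne_zero ht.ne he) h0
      · apply hu
        simpa [inv_smul_smul₀ hc.ne'] using B.smul_mem (inv_nonneg.mpr hc.le) hcu) (by
      intro y
      obtain ⟨r, -, hr⟩ := B.exists_orderUnit (-y)
      refine ⟨⟨r • B.unit, Submodule.smul_mem _ _ (Submodule.mem_span_singleton_self _)⟩,
        0, le_rfl, ?_⟩
      simpa using hr)
  refine ⟨g, ⟨?_, fun v hv => hpos v ⟨0, le_rfl, by simpa using hv⟩⟩, ?_⟩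
  · have h := hg ⟨B.unit, Submodule.mem_span_singleton_self _⟩
    rwa [LinearPMap.mkSpanSingleton_apply] at h
  · have h := hpos (-u) ⟨1, zero_le_one, by simpa using B.zero_mem⟩
    simpa using h

/-- A vector on which every state is nonnegative is positive. -/
theorem AOU.mem_pos_of_forall_isState (B : AOU W) {w : W}
    (h : ∀ g : W →ₗ[ℝ] ℝ, IsState B g → 0 ≤ g w) : w ∈ B.pos := by
  refine B.arch w fun ε hε => ?_
  by_contra hu
  obtain ⟨g, hg, hle⟩ := B.exists_isState_nonpos hu
  have := h g hg
  rw [map_add, map_smul, hg.1, smul_eq_mul, mul_one] at hle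
  linarith

theorem tensFun_tmul (f : V →ₗ[ℝ] ℝ) (g : W →ₗ[ℝ] ℝ) (v : V) (w : W) :
    tensFun f g (v ⊗ₜ[ℝ] w) = f v * g w := by
  simp [tensFun]

theorem simpleCone_subset_injCone (A : AOU V) (B : AOU W) : simpleCone A B ⊆ injCone A B := by
  rintro _ ⟨n, v, w, hv, hw, rfl⟩ f g hf hg
  rw [map_sum]
  refine Finset.sum_nonneg fun i _ => ?_
  rw [tensFun_tmul]
  exact mul_nonneg (hf.2 _ (hv i)) (hg.2 _ (hw i))

theorem tensFun_add_smul_unit {A : AOU V} {B : AOU W} {f : V →ₗ[ℝ] ℝ} {g : W →ₗ[ℝ] ℝ}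
    (hf : IsState A f) (hg : IsState B g) (z : TensorProduct ℝ V W) (ε : ℝ) :
    tensFun f g (z + ε • (A.unit ⊗ₜ[ℝ] B.unit)) = tensFun f g z + ε := by
  rw [map_add, map_smul, tensFun_tmul, hf.1, hg.1, smul_eq_mul, mul_one, mul_one]

theorem projCone_subset_injCone (A : AOU V) (B : AOU W) : projCone A B ⊆ injCone A B := by
  intro z hz f g hf hg
  refine le_of_forall_pos_le_add fun ε hε => ?_
  rw [← tensFun_add_smul_unit hf hg]
  exact simpleCone_subset_injCone A B (hz ε hε) f g hf hg

/-- The `i`-th coordinate of an element of `ℝⁿ ⊗ W`. -/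
noncomputable def tensCoord {n : ℕ} (i : Fin n) : TensorProduct ℝ (Fin n → ℝ) W →ₗ[ℝ] W :=
  TensorProduct.lift (LinearMap.lsmul ℝ W ∘ₗ LinearMap.proj i)

theorem tensCoord_tmul {n : ℕ} (i : Fin n) (v : Fin n → ℝ) (w : W) :
    tensCoord i (v ⊗ₜ[ℝ] w) = v i • w := by
  simp [tensCoord]

theorem eq_sum_single_tmul_tensCoord {n : ℕ} (z : TensorProduct ℝ (Fin n → ℝ) W) :
    z = ∑ i, (Pi.single i 1 : Fin n → ℝ) ⊗ₜ[ℝ] tensCoord i z := by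
  induction z with
  | zero => simp
  | tmul v w =>
    simp_rw [tensCoord_tmul, ← TensorProduct.smul_tmul, ← TensorProduct.sum_tmul]
    congr 1
    exact pi_eq_sum_univ' v
  | add x y hx hy =>
    simp_rw [map_add, TensorProduct.tmul_add, Finset.sum_add_distrib]
    rw [← hx, ← hy]

theorem apply_tensCoord {n : ℕ} (i : Fin n) (g : W →ₗ[ℝ] ℝ)
    (z : TensorProduct ℝ (Fin n → ℝ) W) :
    g (tensCoord i z) = tensFun (LinearMap.proj i) g z := by
  induction z with
  | zero => simp
  | tmul v w => simp [tensCoord_tmul, tensFun_tmul]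
  | add x y hx hy => simp [hx, hy]

theorem injCone_ellInf_subset_simpleCone (n : ℕ) (B : AOU W) :
    injCone (ellInf n) B ⊆ simpleCone (ellInf n) B := by
  intro z hz
  refine ⟨n, fun i => Pi.single i 1, fun i => tensCoord i z, fun i j => ?_, fun i => ?_,
    eq_sum_single_tmul_tensCoord z⟩
  · by_cases h : j = i <;> simp [h]
  · refine B.mem_pos_of_forall_isState fun g hg => ?_
    rw [apply_tensCoord]
    exact hz _ g ⟨rfl, fun v hv => hv i⟩ hg

/-- every element of the injective cone of `ℓ∞_n ⊗ W` is a finite sum of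
elementary tensors of positive elements; consequently `ℓ∞_n` is nuclear. -/
theorem ellInf_nuclear (n : ℕ) (hn : 0 < n) (B : AOU W) :
    (∀ z ∈ injCone (ellInf n) B, z ∈ simpleCone (ellInf n) B) ∧
    injCone (ellInf n) B = projCone (ellInf n) B := by
  refine ⟨fun z hz => injCone_ellInf_subset_simpleCone n B hz,
    Set.Subset.antisymm (fun z hz ε hε => injCone_ellInf_subset_simpleCone n B ?_)
      (projCone_subset_injCone _ B)⟩
  intro f g hf hg
  rw [tensFun_add_smul_unit hf hg]
  exact add_nonneg (hz f g hf hg) hε.le
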